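/- Under the projective Lelieuvre relations in asymptotic coordinates, the compatibility conditions hold: if at a point p ∈ ℝ² one has det(ν,ν_x,ν_y,ν_{xy})(p) ≠ 0, then ν_{xx}(p) and ν_{yy}(p) lie in the linear span of {ν(p), ν_x(p), ν_y(p)}, and f_{xx}(p) and f_{yy}(p) lie in the linear span of {f(p), f_x(p), f_y(p)}. -/

import Mathlib

noncomputable section

/-- Euclidean pairing on `ℝ⁴`. -/
def dot4 (a b : Fin 4 → ℝ) : ℝ := ∑ i, a i * b i

/-- Determinant of the 4×4 matrix with rows `a, b, c, d`. -/
def det4 (a b c d : Fin 4 → ℝ) : ℝ := Matrix.det (Matrix.of ![a, b, c, d])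

/-- Partial derivative in the first (`x`) variable. -/
def dx (g : ℝ × ℝ → Fin 4 → ℝ) : ℝ × ℝ → Fin 4 → ℝ := fun p => fderiv ℝ g p (1, 0)

/-- Partial derivative in the second (`y`) variable. -/
def dy (g : ℝ × ℝ → Fin 4 → ℝ) : ℝ × ℝ → Fin 4 → ℝ := fun p => fderiv ℝ g p (0, 1)

lemma dot4_eq_dotProduct (a b : Fin 4 → ℝ) : dot4 a b = a ⬝ᵥ b := rfl

lemma dot4_comm (a b : Fin 4 → ℝ) : dot4 a b = dot4 b a := dotProduct_comm a b

lemma det4_eq_zero_of_orthogonal {a b c d n : Fin 4 → ℝ} (hn : n ≠ 0) (ha : dot4 a n = 0)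
    (hb : dot4 b n = 0) (hc : dot4 c n = 0) (hd : dot4 d n = 0) : det4 a b c d = 0 := by
  refine Matrix.exists_mulVec_eq_zero_iff.1 ⟨n, hn, ?_⟩
  ext i
  fin_cases i
  exacts [ha, hb, hc, hd]

lemma linearIndependent_of_det4_ne_zero {a b c d : Fin 4 → ℝ} (h : det4 a b c d ≠ 0) :
    LinearIndependent ℝ ![a, b, c, d] :=
  Matrix.linearIndependent_rows_of_det_ne_zero (A := Matrix.of ![a, b, c, d]) h

lemma det4_ne_zero_of_linearIndependent {a b c d : Fin 4 → ℝ}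
    (h : LinearIndependent ℝ ![a, b, c, d]) : det4 a b c d ≠ 0 := by
  have hu : IsUnit (Matrix.of ![a, b, c, d]) := Matrix.linearIndependent_rows_iff_isUnit.1 h
  exact ((Matrix.isUnit_iff_isUnit_det _).1 hu).ne_zero

lemma snoc_vec3 (a b c d : Fin 4 → ℝ) :
    (Fin.snoc ![a, b, c] d : Fin 4 → Fin 4 → ℝ) = ![a, b, c, d] := by
  ext i
  fin_cases i <;> rfl

lemma mem_span_of_orthogonal {a b c d n : Fin 4 → ℝ} (hn : n ≠ 0)
    (hli : LinearIndependent ℝ ![a, b, c]) (ha : dot4 a n = 0) (hb : dot4 b n = 0)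
    (hc : dot4 c n = 0) (hd : dot4 d n = 0) :
    d ∈ Submodule.span ℝ ({a, b, c} : Set (Fin 4 → ℝ)) := by
  by_contra h
  have hrange : Set.range ![a, b, c] = {a, b, c} := by
    simp only [Matrix.range_cons, Matrix.range_empty, Set.union_empty, Set.singleton_union]
  have h4 : LinearIndependent ℝ (Fin.snoc ![a, b, c] d : Fin 4 → Fin 4 → ℝ) :=
    linearIndependent_finSnoc.2 ⟨hli, hrange ▸ h⟩
  rw [snoc_vec3] at h4
  exact det4_ne_zero_of_linearIndependent h4 (det4_eq_zero_of_orthogonal hn ha hb hc hd)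

/-- Leibniz rule for a vanishing pairing. -/
lemma dot4_fderiv_add_eq_zero {g h : ℝ × ℝ → Fin 4 → ℝ} (hg : Differentiable ℝ g)
    (hh : Differentiable ℝ h) (h0 : ∀ q, dot4 (g q) (h q) = 0) (p v : ℝ × ℝ) :
    dot4 (fderiv ℝ g p v) (h p) + dot4 (g p) (fderiv ℝ h p v) = 0 := by
  have hsum : HasFDerivAt (fun q => dot4 (g q) (h q)) _ p :=
    HasFDerivAt.fun_sum (u := Finset.univ) fun i _ =>
      (hasFDerivAt_pi'.1 (hg p).hasFDerivAt i).mul (hasFDerivAt_pi'.1 (hh p).hasFDerivAt i)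
  have hzero : HasFDerivAt (fun q => dot4 (g q) (h q)) (0 : ℝ × ℝ →L[ℝ] ℝ) p := by
    simp only [h0]
    exact hasFDerivAt_const 0 p
  have key := DFunLike.congr_fun (hsum.unique hzero) v
  simp only [dot4, Fin.sum_univ_four] at key ⊢
  simp at key
  linarith

lemma differentiable_fderiv_apply {g : ℝ × ℝ → Fin 4 → ℝ} (hg : ContDiff ℝ 2 g)
    (v : ℝ × ℝ) : Differentiable ℝ fun p => fderiv ℝ g p v :=
  ((hg.fderiv_right (m := 1) one_add_one_eq_two.le).clm_apply contDiff_const).differentiable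
    (by simp)

lemma dx_dy_comm {g : ℝ × ℝ → Fin 4 → ℝ} (hg : ContDiff ℝ 2 g) (p : ℝ × ℝ) :
    dx (dy g) p = dy (dx g) p := by
  have hd : DifferentiableAt ℝ (fderiv ℝ g) p :=
    (hg.fderiv_right (m := 1) one_add_one_eq_two.le).differentiable (by simp) p
  have hsymm : IsSymmSndFDerivAt ℝ g p :=
    hg.contDiffAt.isSymmSndFDerivAt (by simp)
  have happ (v w : ℝ × ℝ) :
      fderiv ℝ (fun q => fderiv ℝ g q v) p w = fderiv ℝ (fderiv ℝ g) p w v := by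
    rw [fderiv_clm_apply hd (differentiableAt_const v)]
    simp
  unfold dx dy
  rw [happ, happ]
  exact hsymm (1, 0) (0, 1)

lemma dot4_self_ne_zero {a : Fin 4 → ℝ} (ha : a ≠ 0) : dot4 a a ≠ 0 :=
  fun h => ha (dotProduct_self_eq_zero.1 h)

lemma det4_second_eq_third (a b c : Fin 4 → ℝ) : det4 a b b c = 0 :=
  Matrix.det_zero_of_row_eq (i := 1) (j := 2) (by decide) rfl

lemma det4_second_eq_fourth (a b c : Fin 4 → ℝ) : det4 a b c b = 0 :=
  Matrix.det_zero_of_row_eq (i := 1) (j := 3) (by decide) rfl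

/-- If `f ∧ g = ε ⋆ (n ∧ m)` with `f ≠ 0`, then anything orthogonal to `f` among `n`, `m` is
orthogonal to `g`. -/
lemma dot4_eq_zero_of_wedge {f g n m z : Fin 4 → ℝ} {ε : ℝ} (hf : f ≠ 0)
    (h : ∀ w z, dot4 w f * dot4 z g - dot4 z f * dot4 w g = ε * det4 w z n m)
    (hz : z = n ∨ z = m) (hfz : dot4 f z = 0) : dot4 g z = 0 := by
  have hdet : det4 f z n m = 0 := by
    rcases hz with rfl | rfl
    exacts [det4_second_eq_third _ _ _, det4_second_eq_fourth _ _ _]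
  have := h f z
  rw [hdet, dot4_comm z f, hfz, mul_zero, zero_mul, sub_zero] at this
  rw [dot4_comm]
  exact (mul_eq_zero.1 this).resolve_left (dot4_self_ne_zero hf)

/-- The orthogonality relations in one coordinate direction `v` implied by the Lelieuvre relation
in that direction. -/
lemma orthogonality_of_lelieuvre {f ν : ℝ × ℝ → Fin 4 → ℝ} {ε : ℝ} {v : ℝ × ℝ}
    (hf : Differentiable ℝ f) (hν : Differentiable ℝ ν) (hpair : ∀ p, dot4 (f p) (ν p) = 0)
    (hL : ∀ p, ∀ w z : Fin 4 → ℝ,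
      dot4 w (f p) * dot4 z (fderiv ℝ f p v) - dot4 z (f p) * dot4 w (fderiv ℝ f p v)
        = ε * det4 w z (ν p) (fderiv ℝ ν p v))
    (hf0 : ∀ p, f p ≠ 0) (p : ℝ × ℝ) :
    dot4 (fderiv ℝ f p v) (ν p) = 0 ∧ dot4 (f p) (fderiv ℝ ν p v) = 0 ∧
      dot4 (fderiv ℝ f p v) (fderiv ℝ ν p v) = 0 := by
  have h1 := dot4_eq_zero_of_wedge (hf0 p) (hL p) (.inl rfl) (hpair p)
  have h2 := dot4_fderiv_add_eq_zero hf hν hpair p v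
  rw [h1, zero_add] at h2
  exact ⟨h1, h2, dot4_eq_zero_of_wedge (hf0 p) (hL p) (.inr rfl) h2⟩

lemma linearIndependent_of_dual_pairing {a b c m n : Fin 4 → ℝ} (ha : a ≠ 0)
    (ham : dot4 a m = 0) (han : dot4 a n = 0) (hbm : dot4 b m = 0) (hcn : dot4 c n = 0)
    (hbn : dot4 b n ≠ 0) (hcm : dot4 c m ≠ 0) : LinearIndependent ℝ ![a, b, c] := by
  simp only [dot4_eq_dotProduct] at *
  rw [Fintype.linearIndependent_iff]
  intro g hg
  simp only [Fin.sum_univ_three, Matrix.cons_val] at hg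
  have hb := congrArg (· ⬝ᵥ n) hg
  have hc := congrArg (· ⬝ᵥ m) hg
  simp only [add_dotProduct, smul_dotProduct, ham, han, hbm, hcn, zero_dotProduct, smul_eq_mul,
    mul_zero, zero_add, add_zero, mul_eq_zero, hbn, hcm, or_false] at hb hc
  rw [hb, hc, zero_smul, zero_smul, add_zero, add_zero] at hg
  have h0 := (smul_eq_zero.1 hg).resolve_right ha
  intro i
  fin_cases i
  exacts [h0, hb, hc]

theorem stmt5 (f ν : ℝ × ℝ → Fin 4 → ℝ)
    (hsf : ContDiff ℝ (⊤ : ℕ∞) f) (hsν : ContDiff ℝ (⊤ : ℕ∞) ν)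
    (hpair : ∀ p, dot4 (f p) (ν p) = 0)
    (hLx : ∀ p, ∀ w z : Fin 4 → ℝ,
      dot4 w (f p) * dot4 z (dx f p) - dot4 z (f p) * dot4 w (dx f p)
        = det4 w z (ν p) (dx ν p))
    (hLy : ∀ p, ∀ w z : Fin 4 → ℝ,
      dot4 w (f p) * dot4 z (dy f p) - dot4 z (f p) * dot4 w (dy f p)
        = - det4 w z (ν p) (dy ν p))
    (hf0 : ∀ p, f p ≠ 0) (hν0 : ∀ p, ν p ≠ 0) :
    ∀ p : ℝ × ℝ, det4 (ν p) (dx ν p) (dy ν p) (dy (dx ν) p) ≠ 0 →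
      dx (dx ν) p ∈ Submodule.span ℝ ({ν p, dx ν p, dy ν p} : Set (Fin 4 → ℝ)) ∧
      dy (dy ν) p ∈ Submodule.span ℝ ({ν p, dx ν p, dy ν p} : Set (Fin 4 → ℝ)) ∧
      dx (dx f) p ∈ Submodule.span ℝ ({f p, dx f p, dy f p} : Set (Fin 4 → ℝ)) ∧
      dy (dy f) p ∈ Submodule.span ℝ ({f p, dx f p, dy f p} : Set (Fin 4 → ℝ)) := by
  intro p hdet
  have hf := hsf.differentiable (by simp)
  have hν := hsν.differentiable (by simp)
  have hsf2 : ContDiff ℝ 2 f := contDiff_infty.1 hsf 2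
  have hsν2 : ContDiff ℝ 2 ν := contDiff_infty.1 hsν 2
  have hox := orthogonality_of_lelieuvre (ε := 1) (v := (1, 0)) hf hν hpair
    (fun p w z => (hLx p w z).trans (one_mul _).symm) hf0
  have hoy := orthogonality_of_lelieuvre (ε := -1) (v := (0, 1)) hf hν hpair
    (fun p w z => (hLy p w z).trans (neg_one_mul _).symm) hf0
  have hfx := differentiable_fderiv_apply hsf2 (1, 0)
  have hfy := differentiable_fderiv_apply hsf2 (0, 1)
  have hνx := differentiable_fderiv_apply hsν2 (1, 0)
  have hνy := differentiable_fderiv_apply hsν2 (0, 1)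
  obtain ⟨fxν, fνx, fxνx⟩ := hox p
  obtain ⟨fyν, fνy, fyνy⟩ := hoy p
  have fνxx := dot4_fderiv_add_eq_zero hf hνx (fun q => (hox q).2.1) p (1, 0)
  have fνyy := dot4_fderiv_add_eq_zero hf hνy (fun q => (hoy q).2.1) p (0, 1)
  have fxxν := dot4_fderiv_add_eq_zero hfx hν (fun q => (hox q).1) p (1, 0)
  have fyyν := dot4_fderiv_add_eq_zero hfy hν (fun q => (hoy q).1) p (0, 1)
  have fyνx := dot4_fderiv_add_eq_zero hf hνx (fun q => (hox q).2.1) p (0, 1)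
  have fxνy := dot4_fderiv_add_eq_zero hf hνy (fun q => (hoy q).2.1) p (1, 0)
  rw [fxνx, zero_add] at fνxx
  rw [fyνy, zero_add] at fνyy
  rw [fxνx, add_zero] at fxxν
  rw [fyνy, add_zero] at fyyν
  have hcomm := dx_dy_comm hsν2 p
  have fνxy : dot4 (f p) (dy (dx ν) p) ≠ 0 := fun h => hdet <|
    det4_eq_zero_of_orthogonal (hf0 p) ((dot4_comm _ _).trans (hpair p))
      ((dot4_comm _ _).trans fνx) ((dot4_comm _ _).trans fνy) ((dot4_comm _ _).trans h)
  have hfyνx : dot4 (dy f p) (dx ν p) ≠ 0 := fun h => fνxy <| by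
    change dot4 (dy f p) (dx ν p) + dot4 (f p) (dy (dx ν) p) = 0 at fyνx
    rwa [h, zero_add] at fyνx
  have hfxνy : dot4 (dx f p) (dy ν p) ≠ 0 := fun h => fνxy <| by
    change dot4 (dx f p) (dy ν p) + dot4 (f p) (dx (dy ν) p) = 0 at fxνy
    rwa [h, zero_add, hcomm] at fxνy
  have hliν : LinearIndependent ℝ ![ν p, dx ν p, dy ν p] := by
    have h4 := linearIndependent_of_det4_ne_zero hdet
    rw [← snoc_vec3] at h4
    exact (linearIndependent_finSnoc.1 h4).1
  have hlif : LinearIndependent ℝ ![f p, dx f p, dy f p] :=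
    linearIndependent_of_dual_pairing (hf0 p) fνx fνy fxνx fyνy hfxνy hfyνx
  have hν_span {d : Fin 4 → ℝ} (hd : dot4 (f p) d = 0) :
      d ∈ Submodule.span ℝ ({ν p, dx ν p, dy ν p} : Set (Fin 4 → ℝ)) :=
    mem_span_of_orthogonal (hf0 p) hliν ((dot4_comm _ _).trans (hpair p))
      ((dot4_comm _ _).trans fνx) ((dot4_comm _ _).trans fνy) ((dot4_comm _ _).trans hd)
  have hf_span {d : Fin 4 → ℝ} (hd : dot4 d (ν p) = 0) :
      d ∈ Submodule.span ℝ ({f p, dx f p, dy f p} : Set (Fin 4 → ℝ)) :=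
    mem_span_of_orthogonal (hν0 p) hlif (hpair p) fxν fyν hd
  exact ⟨hν_span fνxx, hν_span fνyy, hf_span fxxν, hf_span fyyν⟩
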